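/- arXiv:1901.09718 — 2 statements merged into one kernel-verified Lean document; each statement's English description precedes it below -/
import Mathlib

section
/- Let (x̄,ū) be a W^{1,1} local minimizer for (FP3) and let [τ1,τ2] ⊆ [t0,T] with τ1 < τ2 be such that −1 < x̄(t) < 1 for all t ∈ (τ1,τ2). If x̄(τ1) = −1 and x̄(τ2) = 1, then τ2 − τ1 = 2/a and x̄(t) = −1 + a(t − τ1) for all t ∈ [τ1,τ2]. -/
open MeasureTheory Set

noncomputable section

/-- A feasible process for problem (FP3): `x` is the (absolutely continuous) state
trajectory, represented as the indefinite integral of its a.e. derivative `-a*u`,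
`u` is a measurable control with values in `[-1,1]` a.e., the initial condition is
`x t0 = x0`, and the bilateral state constraint `-1 ≤ x t ≤ 1` holds on `[t0,T]`. -/
def FP3Feasible (a t0 T x0 : ℝ) (x u : ℝ → ℝ) : Prop :=
  AEStronglyMeasurable u (volume.restrict (Icc t0 T)) ∧
  (∀ᵐ t ∂(volume.restrict (Icc t0 T)), u t ∈ Icc (-1 : ℝ) 1) ∧
  (∀ t ∈ Icc t0 T, x t = x0 + ∫ s in t0..t, -(a * u s)) ∧
  (∀ t ∈ Icc t0 T, x t ∈ Icc (-1 : ℝ) 1)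

/-- The cost functional of (FP3) on the interval `[t1,t2]`. -/
def FP3Cost (lam t1 t2 : ℝ) (x u : ℝ → ℝ) : ℝ :=
  ∫ t in t1..t2, -(Real.exp (-(lam * t)) * (x t + u t))

/-- `(x,u)` is a `W^{1,1}` local minimizer of (FP3). -/
def FP3LocalMin (a lam t0 T x0 : ℝ) (x u : ℝ → ℝ) : Prop :=
  FP3Feasible a t0 T x0 x u ∧
  ∃ δ > (0 : ℝ), ∀ y v, FP3Feasible a t0 T x0 y v →
    (∫ t in t0..T, |(-(a * v t)) - (-(a * u t))|) ≤ δ →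
    FP3Cost lam t0 T x u ≤ FP3Cost lam t0 T y v

/-- `(x,u)` is a `W^{1,1}` global minimizer of (FP3). -/
def FP3GlobalMin (a lam t0 T x0 : ℝ) (x u : ℝ → ℝ) : Prop :=
  FP3Feasible a t0 T x0 x u ∧
  ∀ y v, FP3Feasible a t0 T x0 y v → FP3Cost lam t0 T x u ≤ FP3Cost lam t0 T y v

/-- The function `Δ(t1,t2) = e^{-λ t1} - 2 e^{-λ (t1+t2)/2} + e^{-λ t2}`. -/
def FP3Delta (lam t1 t2 : ℝ) : ℝ :=
  Real.exp (-(lam * t1)) - 2 * Real.exp (-(lam * (t1 + t2) / 2)) + Real.exp (-(lam * t2))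

/-- The characteristic constant `ρ = (1/λ) ln (a/(a-λ))` of (FP3). -/
def FP3rho (a lam : ℝ) : ℝ := (1 / lam) * Real.log (a / (a - lam))

lemma feas_int {a t0 T x0 : ℝ} {x u : ℝ → ℝ} (htT : t0 < T) (h : FP3Feasible a t0 T x0 x u) :
    IntervalIntegrable u volume t0 T := by
  obtain ⟨hm, hb, -, -⟩ := h
  rw [intervalIntegrable_iff_integrableOn_Icc_of_le htT.le]
  refine Integrable.of_bound hm 1 ?_
  filter_upwards [hb] with t ht
  rw [Real.norm_eq_abs, abs_le]; exact ht

lemma feas_sub {u : ℝ → ℝ} {t0 T s t : ℝ} (hu : IntervalIntegrable u volume t0 T)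
    (hs : s ∈ Icc t0 T) (ht : t ∈ Icc t0 T) : IntervalIntegrable u volume s t := by
  refine hu.mono_set ?_
  rw [uIcc_of_le (hs.1.trans hs.2)]
  exact uIcc_subset_Icc hs ht

lemma feas_ac {a t0 T x0 : ℝ} {x u : ℝ → ℝ} (htT : t0 < T) (h : FP3Feasible a t0 T x0 x u) :
    ContinuousOn x (Icc t0 T) := by
  have hi : IntervalIntegrable (fun s => -(a * u s)) volume t0 T := ((feas_int htT h).const_mul a).neg
  have := (hi.absolutelyContinuousOnInterval_intervalIntegral (c := t0) (by simp)).continuousOn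
  rw [uIcc_of_le htT.le] at this
  exact (continuousOn_const.add this).congr h.2.2.1

lemma exp_ac {lam t0 T : ℝ} (hlam : 0 < lam) (ht0 : 0 ≤ t0) (htT : t0 < T) :
    AbsolutelyContinuousOnInterval (fun t => Real.exp (-(lam * t))) t0 T := by
  have : LipschitzOnWith lam.toNNReal (fun t => Real.exp (-(lam * t))) (uIcc t0 T) := by
    rw [uIcc_of_le htT.le]
    refine (convex_Icc t0 T).lipschitzOnWith_of_nnnorm_hasDerivWithin_le
      (f' := fun t => Real.exp (-(lam * t)) * (-(lam * 1))) ?_ ?_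
    · intro t ht
      exact (((hasDerivAt_id t).const_mul lam).neg.exp).hasDerivWithinAt
    · intro t ht
      rw [← NNReal.coe_le_coe]
      simp only [coe_nnnorm, norm_mul, Real.norm_eq_abs, Real.abs_exp, abs_neg, mul_one, abs_of_pos hlam, Real.coe_toNNReal _ hlam.le]
      have : Real.exp (-(lam * t)) ≤ 1 := Real.exp_le_one_iff.2 (by nlinarith [ht.1])
      nlinarith
  exact this.absolutelyContinuousOnInterval

lemma cost_formula {a lam t0 T x0 : ℝ} (hal : lam < a) (hlam : 0 < lam) (ht0 : 0 ≤ t0) (htT : t0 < T)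
    {x u : ℝ → ℝ} (h : FP3Feasible a t0 T x0 x u) :
    a * FP3Cost lam t0 T x u = Real.exp (-(lam * T)) * x T - Real.exp (-(lam * t0)) * x0
      - (a - lam) * ∫ t in t0..T, Real.exp (-(lam * t)) * x t := by
  have hu := feas_int htT h
  have hx := feas_ac htT h
  have hi : IntervalIntegrable (fun s => -(a * u s)) volume t0 T := (hu.const_mul a).neg
  have hac := hi.absolutelyContinuousOnInterval_intervalIntegral (c := t0) (by simp)
  have hec : Continuous fun t : ℝ => Real.exp (-(lam * t)) := by fun_prop
  have hp := (exp_ac hlam ht0 htT).integral_mul_deriv_eq_deriv_mul hac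
  have e1 : ∫ t in t0..T, Real.exp (-(lam * t)) * deriv (fun x => ∫ v in t0..x, -(a * u v)) t
      = ∫ t in t0..T, Real.exp (-(lam * t)) * (-(a * u t)) := by
    refine intervalIntegral.integral_congr_ae ?_
    filter_upwards [hi.ae_hasDerivAt_integral] with t ht htm
    rw [(ht (uIoc_subset_uIcc htm) t0 (by simp)).deriv]
  have hd : ∀ t, deriv (fun t => Real.exp (-(lam * t))) t = Real.exp (-(lam * t)) * (-(lam * 1)) :=
    fun t => (((hasDerivAt_id t).const_mul lam).neg.exp).deriv
  have e2 : ∫ t in t0..T, deriv (fun t => Real.exp (-(lam * t))) t * (∫ v in t0..t, -(a * u v))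
      = ∫ t in t0..T, (-lam * (Real.exp (-(lam * t)) * x t) + x0 * (lam * Real.exp (-(lam * t)))) := by
    refine intervalIntegral.integral_congr fun t ht => ?_
    rw [uIcc_of_le htT.le] at ht
    simp only [hd]
    rw [h.2.2.1 t ht]; ring
  have iex : IntervalIntegrable (fun t => Real.exp (-(lam * t)) * x t) volume t0 T := by
    refine ContinuousOn.intervalIntegrable ?_
    rw [uIcc_of_le htT.le]
    exact hec.continuousOn.mul hx
  have iee : IntervalIntegrable (fun t => x0 * (lam * Real.exp (-(lam * t)))) volume t0 T :=
    Continuous.intervalIntegrable (by fun_prop) _ _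
  have e3 : ∫ t in t0..T, x0 * (lam * Real.exp (-(lam * t))) =
      -(x0 * Real.exp (-(lam * T))) - -(x0 * Real.exp (-(lam * t0))) := by
    refine intervalIntegral.integral_eq_sub_of_hasDerivAt (f := fun t => -(x0 * Real.exp (-(lam * t)))) (fun t _ => ?_) iee
    have h0 : HasDerivAt (fun t => Real.exp (-(lam * t))) (Real.exp (-(lam * t)) * (-(lam * 1))) t :=
      ((hasDerivAt_id t).const_mul lam).neg.exp
    exact ((h0.const_mul x0).neg).congr_deriv (by ring)
  rw [e1, e2, intervalIntegral.integral_add (iex.const_mul _) iee, e3, intervalIntegral.integral_const_mul] at hp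
  have iu : IntervalIntegrable (fun t => Real.exp (-(lam * t)) * (-(a * u t))) volume t0 T :=
    hi.continuousOn_mul hec.continuousOn
  have e4 : a * FP3Cost lam t0 T x u = (∫ t in t0..T, Real.exp (-(lam * t)) * (-(a * u t)))
      + (-a) * ∫ t in t0..T, Real.exp (-(lam * t)) * x t := by
    rw [FP3Cost, ← intervalIntegral.integral_const_mul, ← intervalIntegral.integral_const_mul,
      ← intervalIntegral.integral_add iu (iex.const_mul _)]
    congr 1; ext t; ring
  rw [e4, hp, h.2.2.1 T ⟨htT.le, le_rfl⟩]
  simp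
  ring

lemma combo_feas {a t0 T x0 : ℝ} (htT : t0 < T) {x u y v : ℝ → ℝ} (h : FP3Feasible a t0 T x0 x u)
    (h' : FP3Feasible a t0 T x0 y v) {ε : ℝ} (e0 : 0 ≤ ε) (e1 : ε ≤ 1) :
    FP3Feasible a t0 T x0 (fun t => (1 - ε) * x t + ε * y t) (fun t => (1 - ε) * u t + ε * v t) := by
  refine ⟨(h.1.const_mul _).add (h'.1.const_mul _), ?_, ?_, ?_⟩
  · filter_upwards [h.2.1, h'.2.1] with t ⟨p, q⟩ ⟨r, s⟩
    constructor <;> nlinarith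
  · intro t ht
    have ht0 : t0 ∈ Icc t0 T := ⟨le_rfl, htT.le⟩
    have i1 : IntervalIntegrable (fun s => -(a * u s)) volume t0 t :=
      ((feas_sub (feas_int htT h) ht0 ht).const_mul a).neg
    have i2 : IntervalIntegrable (fun s => -(a * v s)) volume t0 t :=
      ((feas_sub (feas_int htT h') ht0 ht).const_mul a).neg
    have : ∫ s in t0..t, -(a * ((1 - ε) * u s + ε * v s)) =
        (1 - ε) * (∫ s in t0..t, -(a * u s)) + ε * ∫ s in t0..t, -(a * v s) := by
      rw [← intervalIntegral.integral_const_mul, ← intervalIntegral.integral_const_mul,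
        ← intervalIntegral.integral_add (i1.const_mul _) (i2.const_mul _)]
      congr 1; ext t; ring
    simp only [this]
    rw [h.2.2.1 t ht, h'.2.2.1 t ht]; ring
  · intro t ht
    obtain ⟨p, q⟩ := h.2.2.2 t ht
    obtain ⟨r, s⟩ := h'.2.2.2 t ht
    constructor <;> nlinarith

/-- A feasible competitor with the same endpoint that lies above a local minimizer coincides with it. -/
lemma max_eq {a lam t0 T x0 : ℝ} (hal : lam < a) (hlam : 0 < lam) (ht0 : 0 ≤ t0) (htT : t0 < T)
    {x u y v : ℝ → ℝ} (hmin : FP3LocalMin a lam t0 T x0 x u) (h' : FP3Feasible a t0 T x0 y v)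
    (hT : y T = x T) (hle : ∀ t ∈ Icc t0 T, x t ≤ y t) : ∀ t ∈ Icc t0 T, x t = y t := by
  obtain ⟨h, δ, hδ, hloc⟩ := hmin
  have hx := feas_ac htT h
  have hy := feas_ac htT h'
  have hec : Continuous fun t : ℝ => Real.exp (-(lam * t)) := by fun_prop
  by_contra! hne
  obtain ⟨c, hc, hcne⟩ := hne
  have hlt : ∫ t in t0..T, Real.exp (-(lam * t)) * x t < ∫ t in t0..T, Real.exp (-(lam * t)) * y t := by
    refine intervalIntegral.integral_lt_integral_of_continuousOn_of_le_of_exists_lt htT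
      (hec.continuousOn.mul hx) (hec.continuousOn.mul hy) (fun t ht => ?_) ⟨c, hc, ?_⟩
    · exact mul_le_mul_of_nonneg_left (hle t ⟨ht.1.le, ht.2⟩) (Real.exp_pos _).le
    · exact mul_lt_mul_of_pos_left (lt_of_le_of_ne (hle c hc) hcne) (Real.exp_pos _)
  set D := ∫ t in t0..T, |a * (v t - u t)| with hD
  have hD0 : 0 ≤ D := intervalIntegral.integral_nonneg htT.le fun t _ => abs_nonneg _
  obtain ⟨ε, e0, e1, e2⟩ : ∃ ε : ℝ, 0 < ε ∧ ε ≤ 1 ∧ ε * D ≤ δ := by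
    refine ⟨min 1 (δ / (D + 1)), by positivity, min_le_left _ _, ?_⟩
    calc _ ≤ δ / (D + 1) * D := by gcongr; exact min_le_right _ _
      _ ≤ δ / (D + 1) * (D + 1) := by gcongr; linarith
      _ = δ := by field_simp
  have hf := combo_feas htT h h' e0.le e1
  have hcost := hloc _ _ hf (by
    refine le_trans (le_of_eq ?_) e2
    rw [hD, ← intervalIntegral.integral_const_mul]
    congr 1; ext t
    rw [← abs_of_pos e0, ← abs_mul, abs_of_pos e0, ← abs_neg]
    congr 1; ring)
  have c1 := cost_formula hal hlam ht0 htT h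
  have c2 := cost_formula hal hlam ht0 htT hf
  have iex : IntervalIntegrable (fun t => Real.exp (-(lam * t)) * x t) volume t0 T := by
    refine ContinuousOn.intervalIntegrable ?_
    rw [uIcc_of_le htT.le]
    exact hec.continuousOn.mul hx
  have iey : IntervalIntegrable (fun t => Real.exp (-(lam * t)) * y t) volume t0 T := by
    refine ContinuousOn.intervalIntegrable ?_
    rw [uIcc_of_le htT.le]
    exact hec.continuousOn.mul hy
  have e3 : ∫ t in t0..T, Real.exp (-(lam * t)) * ((1 - ε) * x t + ε * y t) =
      (1 - ε) * (∫ t in t0..T, Real.exp (-(lam * t)) * x t)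
      + ε * ∫ t in t0..T, Real.exp (-(lam * t)) * y t := by
    rw [← intervalIntegral.integral_const_mul, ← intervalIntegral.integral_const_mul,
        ← intervalIntegral.integral_add (iex.const_mul _) (iey.const_mul _)]
    congr 1; ext t; ring
  simp only [e3, hT] at c2
  have k1 := mul_le_mul_of_nonneg_left hcost (hlam.trans hal).le
  rw [c1, c2] at k1
  have k2 := mul_pos (mul_pos e0 (sub_pos.2 hal)) (sub_pos.2 hlt)
  nlinarith

/-- The state grows at rate at most `a`. -/
lemma feas_lip {a t0 T x0 : ℝ} (ha : 0 < a) (htT : t0 < T) {x u : ℝ → ℝ} (h : FP3Feasible a t0 T x0 x u)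
    {s t : ℝ} (hs : t0 ≤ s) (hst : s ≤ t) (ht : t ≤ T) : x t - x s ≤ a * (t - s) := by
  have hu := feas_int htT h
  have m0 : t0 ∈ Icc t0 T := ⟨le_rfl, htT.le⟩
  have ms : s ∈ Icc t0 T := ⟨hs, hst.trans ht⟩
  have mt : t ∈ Icc t0 T := ⟨hs.trans hst, ht⟩
  have hi : IntervalIntegrable (fun s => -(a * u s)) volume t0 T := (hu.const_mul a).neg
  rw [h.2.2.1 t mt, h.2.2.1 s ms, add_sub_add_left_eq_sub,
    intervalIntegral.integral_interval_sub_left (feas_sub hi m0 mt) (feas_sub hi m0 ms)]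
  calc _ ≤ ∫ r in s..t, a := by
        refine intervalIntegral.integral_mono_ae_restrict hst (feas_sub hi ms mt) (by simp) ?_
        have := ae_restrict_of_ae_restrict_of_subset (Icc_subset_Icc hs ht) h.2.1
        filter_upwards [this] with r hr
        nlinarith [hr.1]
    _ = _ := by simp; ring

/-- The competitor control. -/
def compCtl (u : ℝ → ℝ) (p q r : ℝ) : ℝ → ℝ :=
  (Ioc p q).piecewise (fun _ => -1) ((Ioc q r).piecewise (fun _ => 0) u)

/-- If a local minimizer's trajectory stays in `(-1,1)` on `(τ1,τ2)`
and goes from `-1` at `τ1` to `1` at `τ2`, then `τ2 - τ1 = 2/a` and the trajectory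
is the line `-1 + a (t - τ1)` on `[τ1,τ2]`. -/
theorem fp3_statement_S1
    (a lam t0 T x0 : ℝ) (hal : lam < a) (hlam : 0 < lam)
    (ht0 : 0 ≤ t0) (htT : t0 < T) (hx0 : x0 ∈ Icc (-1 : ℝ) 1)
    (xb ub : ℝ → ℝ) (hmin : FP3LocalMin a lam t0 T x0 xb ub)
    (τ1 τ2 : ℝ) (h1 : t0 ≤ τ1) (h12 : τ1 < τ2) (h2 : τ2 ≤ T)
    (hin : ∀ t ∈ Ioo τ1 τ2, xb t ∈ Ioo (-1 : ℝ) 1)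
    (ha1 : xb τ1 = -1) (ha2 : xb τ2 = 1) :
    τ2 - τ1 = 2 / a ∧ ∀ t ∈ Icc τ1 τ2, xb t = -1 + a * (t - τ1) := by
  obtain ⟨h, -⟩ := id hmin
  have ha : 0 < a := hlam.trans hal
  set q := τ1 + 2 / a with hq
  have haq : a * (q - τ1) = 2 := by rw [hq]; field_simp; ring
  have h1q : τ1 ≤ q := by rw [hq]; have : 0 < 2 / a := by positivity
                          linarith
  have hqr : q ≤ τ2 := by
    have := feas_lip ha htT h h1 h12.le h2
    rw [ha1, ha2] at this
    nlinarith
  set v := compCtl ub τ1 q τ2 with hv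
  set y : ℝ → ℝ := fun t => x0 + ∫ s in t0..t, -(a * v s) with hy
  have m0 : t0 ∈ Icc t0 T := ⟨le_rfl, htT.le⟩
  have m1 : τ1 ∈ Icc t0 T := ⟨h1, h12.le.trans h2⟩
  have mq : q ∈ Icc t0 T := ⟨h1.trans h1q, hqr.trans h2⟩
  have m2 : τ2 ∈ Icc t0 T := ⟨h1.trans h12.le, h2⟩
  have hvm : AEStronglyMeasurable v (volume.restrict (Icc t0 T)) :=
    AEStronglyMeasurable.piecewise measurableSet_Ioc aestronglyMeasurable_const
      (AEStronglyMeasurable.piecewise measurableSet_Ioc aestronglyMeasurable_const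
        h.1.restrict).restrict
  have hvb : ∀ᵐ t ∂(volume.restrict (Icc t0 T)), v t ∈ Icc (-1 : ℝ) 1 := by
    filter_upwards [h.2.1] with t ht
    simp only [hv, compCtl, piecewise]
    split_ifs
    · norm_num
    · norm_num
    · exact ht
  have hvi : IntervalIntegrable v volume t0 T := by
    rw [intervalIntegrable_iff_integrableOn_Icc_of_le htT.le]
    refine Integrable.of_bound hvm 1 ?_
    filter_upwards [hvb] with t ht
    rw [Real.norm_eq_abs, abs_le]; exact ht
  have hvi' : IntervalIntegrable (fun s => -(a * v s)) volume t0 T := (hvi.const_mul a).neg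
  have hui' : IntervalIntegrable (fun s => -(a * ub s)) volume t0 T :=
    ((feas_int htT h).const_mul a).neg
  have ystep : ∀ s ∈ Icc t0 T, ∀ t ∈ Icc t0 T, y t = y s + ∫ r in s..t, -(a * v r) := by
    intro s hs t ht
    simp only [hy]
    rw [← intervalIntegral.integral_add_adjacent_intervals (feas_sub hvi' m0 hs) (feas_sub hvi' hs ht)]
    ring
  have y1 : ∀ t ∈ Icc t0 τ1, y t = xb t := by
    intro t ht
    rw [h.2.2.1 t ⟨ht.1, ht.2.trans m1.2⟩]
    simp only [hy]
    congr 1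
    refine intervalIntegral.integral_congr fun s hs => ?_
    rw [uIcc_of_le ht.1] at hs
    have a1 : s ∉ Ioc τ1 q := fun hh => by linarith [hh.1, hs.2, ht.2]
    have a2 : s ∉ Ioc q τ2 := fun hh => by linarith [hh.1, hs.2, ht.2]
    simp [hv, compCtl, piecewise_eq_of_notMem _ _ _ a1, piecewise_eq_of_notMem _ _ _ a2]
  have y2 : ∀ t ∈ Icc τ1 q, y t = -1 + a * (t - τ1) := by
    intro t ht
    rw [ystep τ1 m1 t ⟨h1.trans ht.1, ht.2.trans mq.2⟩, y1 τ1 ⟨h1, le_rfl⟩, ha1]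
    congr 1
    have : ∫ r in τ1..t, -(a * v r) = ∫ r in τ1..t, a := by
      refine intervalIntegral.integral_congr_ae (ae_of_all _ fun s hs => ?_)
      rw [uIoc_of_le ht.1] at hs
      have a1 : s ∈ Ioc τ1 q := ⟨hs.1, hs.2.trans ht.2⟩
      simp [hv, compCtl, piecewise_eq_of_mem _ _ _ a1]
    rw [this]; simp; ring
  have yq : y q = 1 := by rw [y2 q ⟨h1q, le_rfl⟩, haq]; norm_num
  have y3 : ∀ t ∈ Icc q τ2, y t = 1 := by
    intro t ht
    rw [ystep q mq t ⟨mq.1.trans ht.1, ht.2.trans h2⟩, yq]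
    have : ∫ r in q..t, -(a * v r) = ∫ r in q..t, 0 := by
      refine intervalIntegral.integral_congr_ae (ae_of_all _ fun s hs => ?_)
      rw [uIoc_of_le ht.1] at hs
      have a1 : s ∉ Ioc τ1 q := fun hh => by linarith [hh.2, hs.1]
      have a2 : s ∈ Ioc q τ2 := ⟨hs.1, hs.2.trans ht.2⟩
      simp [hv, compCtl, piecewise_eq_of_notMem _ _ _ a1, piecewise_eq_of_mem _ _ _ a2]
    rw [this]; simp
  have y4 : ∀ t ∈ Icc τ2 T, y t = xb t := by
    intro t ht
    have mt : t ∈ Icc t0 T := ⟨m2.1.trans ht.1, ht.2⟩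
    have hxs : xb t = xb τ2 + ∫ r in τ2..t, -(a * ub r) := by
      rw [h.2.2.1 t mt, h.2.2.1 τ2 m2, ← intervalIntegral.integral_add_adjacent_intervals
        (feas_sub hui' m0 m2) (feas_sub hui' m2 mt)]
      ring
    rw [ystep τ2 m2 t mt, y3 τ2 ⟨hqr, le_rfl⟩, hxs, ha2]
    congr 1
    refine intervalIntegral.integral_congr_ae (ae_of_all _ fun s hs => ?_)
    rw [uIoc_of_le ht.1] at hs
    have a1 : s ∉ Ioc τ1 q := fun hh => by linarith [hh.2, hs.1]
    have a2 : s ∉ Ioc q τ2 := fun hh => by linarith [hh.2, hs.1]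
    simp [hv, compCtl, piecewise_eq_of_notMem _ _ _ a1, piecewise_eq_of_notMem _ _ _ a2]
  have key : ∀ t ∈ Icc t0 T, y t ∈ Icc (-1 : ℝ) 1 ∧ xb t ≤ y t := by
    intro t ht
    have hxt := h.2.2.2 t ht
    rcases le_total t τ1 with c | c
    · rw [y1 t ⟨ht.1, c⟩]; exact ⟨hxt, le_rfl⟩
    rcases le_total t q with d | d
    · have := feas_lip ha htT h h1 c ht.2
      rw [y2 t ⟨c, d⟩]
      refine ⟨⟨by nlinarith, by nlinarith⟩, by linarith⟩
    rcases le_total t τ2 with e | e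
    · rw [y3 t ⟨d, e⟩]; exact ⟨by norm_num, hxt.2⟩
    · rw [y4 t ⟨e, ht.2⟩]; exact ⟨hxt, le_rfl⟩
  have hfy : FP3Feasible a t0 T x0 y v := ⟨hvm, hvb, fun t _ => rfl, fun t ht => (key t ht).1⟩
  have heq := max_eq hal hlam ht0 htT hmin hfy (y4 T ⟨h2, le_rfl⟩) fun t ht => (key t ht).2
  have hq2 : q = τ2 := by
    by_contra hne
    have hlt : q < τ2 := lt_of_le_of_ne hqr hne
    have hqp : τ1 < q := by rw [hq]; have : 0 < 2 / a := by positivity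
                            linarith
    have := (hin q ⟨hqp, hlt⟩).2
    rw [heq q mq, yq] at this
    exact lt_irrefl _ this
  refine ⟨by rw [← hq2, hq]; ring, fun t ht => ?_⟩
  rw [heq t ⟨h1.trans ht.1, ht.2.trans h2⟩, y2 t ⟨ht.1, hq2 ▸ ht.2⟩]
end
end

section
/- Let (x̄,ū) be a W^{1,1} local minimizer for (FP3). Then x̄(t) > −1 for all t in the open interval (t0, T). -/
open MeasureTheory Set

noncomputable section

lemma fp3_cost_formula (a lam t0 T : ℝ) (ha : 0 < a) (K : NNReal) (Z : ℝ → ℝ)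
    (hZ : LipschitzWith K Z) :
    ∫ t in t0..T, -(Real.exp (-(lam * t)) * (Z t + -(deriv Z t / a))) =
      (Real.exp (-(lam * T)) * Z T - Real.exp (-(lam * t0)) * Z t0) / a
        - (1 - lam / a) * ∫ t in t0..T, Real.exp (-(lam * t)) * Z t := by
  have hE : ∀ t, HasDerivAt (fun t : ℝ => Real.exp (-(lam * t)))
      (Real.exp (-(lam * t)) * (-(lam * 1))) t := fun t =>
    (((hasDerivAt_id t).const_mul lam).neg).exp
  have hZac : AbsolutelyContinuousOnInterval Z t0 T :=
    (hZ.lipschitzOnWith).absolutelyContinuousOnInterval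
  have hEac : AbsolutelyContinuousOnInterval (fun t : ℝ => Real.exp (-(lam * t))) t0 T := by
    apply ContDiffOn.absolutelyContinuousOnInterval
    apply ContDiff.contDiffOn
    fun_prop
  have hEc : Continuous (fun t : ℝ => Real.exp (-(lam * t))) := by fun_prop
  have hparts := hEac.integral_mul_deriv_eq_deriv_mul hZac
  have h1 : ∫ t in t0..T, deriv (fun t : ℝ => Real.exp (-(lam * t))) t * Z t
      = -lam * ∫ t in t0..T, Real.exp (-(lam * t)) * Z t := by
    rw [← intervalIntegral.integral_const_mul]
    congr 1
    funext t
    rw [(hE t).deriv]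
    ring
  rw [h1] at hparts
  have hi1 : IntervalIntegrable (fun t => Real.exp (-(lam * t)) * Z t) volume t0 T :=
    (hEc.mul hZ.continuous).intervalIntegrable _ _
  have hi2 : IntervalIntegrable (fun t => Real.exp (-(lam * t)) * deriv Z t) volume t0 T :=
    hZac.intervalIntegrable_deriv.continuousOn_mul hEc.continuousOn
  have h2 : ∫ t in t0..T, -(Real.exp (-(lam * t)) * (Z t + -(deriv Z t / a)))
      = (∫ t in t0..T, (1 / a) * (Real.exp (-(lam * t)) * deriv Z t))
        - ∫ t in t0..T, Real.exp (-(lam * t)) * Z t := by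
    rw [← intervalIntegral.integral_sub (hi2.const_mul _) hi1]
    congr 1
    funext t
    ring
  rw [h2, intervalIntegral.integral_const_mul, hparts]
  field_simp
  ring

/-- Proposition 3.7: the trajectory of a local minimizer stays
strictly above the lower boundary `-1` on the open interval `(t0,T)`. -/
theorem fp3_above_lower_boundary
    (a lam t0 T x0 : ℝ) (hal : lam < a) (hlam : 0 < lam)
    (ht0 : 0 ≤ t0) (htT : t0 < T) (hx0 : x0 ∈ Icc (-1 : ℝ) 1)
    (xb ub : ℝ → ℝ) (hmin : FP3LocalMin a lam t0 T x0 xb ub) :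
    ∀ t ∈ Ioo t0 T, -1 < xb t := by
  have ha : 0 < a := hlam.trans hal
  obtain ⟨⟨hum, hub, hx, hxb⟩, δ, hδ, hopt⟩ := hmin
  intro τ hτ
  by_contra hcon
  have hτI : τ ∈ Icc t0 T := Ioo_subset_Icc_self hτ
  have hxτ : xb τ = -1 := le_antisymm (not_lt.mp hcon) (hxb τ hτI).1
  -- the globally extended derivative
  set g : ℝ → ℝ := (Icc t0 T).indicator (fun s => -(a * ub s)) with hg
  have hgm : AEStronglyMeasurable g volume := by
    rw [hg, aestronglyMeasurable_indicator_iff measurableSet_Icc]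
    exact (hum.const_mul a).neg
  have hgb : ∀ᵐ t, ‖g t‖ ≤ a := by
    have := (ae_restrict_iff' measurableSet_Icc).mp hub
    filter_upwards [this] with t ht
    by_cases h : t ∈ Icc t0 T
    · have h' := ht h
      rw [hg, indicator_of_mem h, norm_neg, norm_mul, Real.norm_of_nonneg ha.le]
      have : ‖ub t‖ ≤ 1 := abs_le.mpr h'
      nlinarith
    · rw [hg, indicator_of_notMem h]
      simpa using ha.le
  have hgl : LocallyIntegrable g volume := by
    apply (memLp_top_of_bound hgm a hgb).locallyIntegrable
    exact le_top
  have hgi : ∀ p q, IntervalIntegrable g volume p q := fun p q =>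
    (hgl.integrableOn_isCompact isCompact_uIcc).intervalIntegrable
  set X : ℝ → ℝ := fun t => x0 + ∫ s in t0..t, g s with hX
  have hXlip : LipschitzWith ⟨a, ha.le⟩ X := by
    apply LipschitzWith.of_dist_le_mul
    intro p q
    rw [Real.dist_eq, Real.dist_eq, hX]
    have : (x0 + ∫ s in t0..p, g s) - (x0 + ∫ s in t0..q, g s) = ∫ s in q..p, g s := by
      rw [← intervalIntegral.integral_interval_sub_left (hgi t0 p) (hgi t0 q)]
      ring
    simp only [this]
    exact intervalIntegral.norm_integral_le_of_norm_le_const_ae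
      (hgb.mono fun t ht _ => ht)
  have hXx : ∀ t ∈ Icc t0 T, X t = xb t := by
    intro t ht
    rw [hx t ht]
    refine congrArg (fun z => x0 + z) ?_
    apply intervalIntegral.integral_congr
    intro s hs
    rw [uIcc_of_le ht.1] at hs
    have hsI : s ∈ Icc t0 T := ⟨hs.1, hs.2.trans ht.2⟩
    have h3 : g s = -(a * ub s) := indicator_of_mem hsI _
    exact h3
  have hXd : ∀ᵐ t, deriv X t = g t := by
    filter_upwards [LocallyIntegrable.ae_hasDerivAt_integral hgl] with t ht
    exact ((ht t0).const_add x0).deriv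
  -- the bump
  obtain ⟨ε, hε, hε1, hε2, hε3, hε4⟩ : ∃ ε : ℝ, 0 < ε ∧ ε ≤ δ / 4 ∧ ε ≤ 2 ∧
      ε ≤ a * (τ - t0) ∧ ε ≤ a * (T - τ) := by
    have h3 : 0 < a * (τ - t0) := mul_pos ha (sub_pos.mpr hτ.1)
    have h4 : 0 < a * (T - τ) := mul_pos ha (sub_pos.mpr hτ.2)
    refine ⟨min (min (δ / 4) 2) (min (a * (τ - t0)) (a * (T - τ))), ?_, ?_, ?_, ?_, ?_⟩
    · exact lt_min (lt_min (by positivity) (by norm_num)) (lt_min h3 h4)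
    · exact (min_le_left _ _).trans (min_le_left _ _)
    · exact (min_le_left _ _).trans (min_le_right _ _)
    · exact (min_le_right _ _).trans (min_le_left _ _)
    · exact (min_le_right _ _).trans (min_le_right _ _)
  set φ : ℝ → ℝ := fun t => -1 + ε - a * |t - τ| with hφ
  have hφlip : LipschitzWith ⟨a, ha.le⟩ φ := by
    apply LipschitzWith.of_dist_le_mul
    intro p q
    rw [Real.dist_eq, Real.dist_eq, hφ]
    have h1 : (-1 + ε - a * |p - τ|) - (-1 + ε - a * |q - τ|) = a * (|q - τ| - |p - τ|) := by ring
    simp only [h1]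
    rw [abs_mul, abs_of_pos ha]
    apply mul_le_mul_of_nonneg_left _ ha.le
    have := abs_abs_sub_abs_le_abs_sub (q - τ) (p - τ)
    rw [show q - τ - (p - τ) = q - p by ring, abs_sub_comm q p] at this
    exact this
  set Y : ℝ → ℝ := fun t => max (X t) (φ t) with hY
  have hYlip : LipschitzWith ⟨a, ha.le⟩ Y := by
    have := hXlip.max hφlip
    exact this.weaken (max_le le_rfl le_rfl)
  have hX1 : ∀ t ∈ Icc t0 T, -1 ≤ X t ∧ X t ≤ 1 := fun t ht => by
    rw [hXx t ht]; exact hxb t ht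
  have hYout : ∀ t ∈ Icc t0 T, ε ≤ a * |t - τ| → Y t = X t := by
    intro t ht h
    apply max_eq_left
    have := (hX1 t ht).1
    simp only [hφ]
    linarith
  have ht0I : t0 ∈ Icc t0 T := ⟨le_rfl, htT.le⟩
  have hTI : T ∈ Icc t0 T := ⟨htT.le, le_rfl⟩
  have hYt0 : Y t0 = X t0 := by
    apply hYout t0 ht0I
    rw [abs_sub_comm, abs_of_pos (sub_pos.mpr hτ.1)]
    exact hε3
  have hYT : Y T = X T := by
    apply hYout T hTI
    rw [abs_of_pos (sub_pos.mpr hτ.2)]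
    exact hε4
  have hXt0 : X t0 = x0 := by simp [hX]
  have hYd : ∀ t, |deriv Y t| ≤ a := fun t => norm_deriv_le_of_lipschitz hYlip
  set v : ℝ → ℝ := fun t => -(deriv Y t / a) with hv
  have hav : ∀ t, -(a * v t) = deriv Y t := by
    intro t
    simp only [hv]
    field_simp
    try ring
  have hfeas : FP3Feasible a t0 T x0 Y v := by
    refine ⟨?_, ?_, ?_, ?_⟩
    · exact ((measurable_deriv Y).div_const a).neg.aestronglyMeasurable
    · refine Filter.Eventually.of_forall fun t => ?_
      have := hYd t
      apply abs_le.mp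
      simp only [hv]
      rw [abs_neg, abs_div, abs_of_pos ha, div_le_one ha]
      exact this
    · intro t ht
      simp only [hav]
      rw [(hYlip.lipschitzOnWith.absolutelyContinuousOnInterval).integral_deriv_eq_sub,
        hYt0, hXt0]
      ring
    · intro t ht
      refine ⟨(hX1 t ht).1.trans (le_max_left _ _), max_le (hX1 t ht).2 ?_⟩
      have : 0 ≤ a * |t - τ| := by positivity
      simp only [hφ]
      linarith
  have hdist : (∫ t in t0..T, |(-(a * v t)) - (-(a * ub t))|) ≤ δ := by
    have hr : 0 < ε / a := by positivity
    set S : Set ℝ := Icc (τ - ε / a) (τ + ε / a) with hS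
    have hbd : ∀ᵐ t, t ∈ Ioo t0 T →
        |(-(a * v t)) - (-(a * ub t))| ≤ S.indicator (fun _ => 2 * a) t := by
      filter_upwards [hXd, hgb] with t h1 h2 ht
      have htI := Ioo_subset_Icc_self ht
      have h3 : g t = -(a * ub t) := indicator_of_mem htI _
      rw [hav, ← h3]
      by_cases hts : t ∈ S
      · rw [indicator_of_mem hts]
        have h4 := hYd t
        rw [Real.norm_eq_abs] at h2
        have := abs_sub (deriv Y t) (g t)
        linarith
      · rw [indicator_of_notMem hts]
        have hev : Y =ᶠ[nhds t] X := by
          have ho : IsOpen (Sᶜ ∩ Ioo t0 T) := isClosed_Icc.isOpen_compl.inter isOpen_Ioo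
          filter_upwards [ho.mem_nhds ⟨hts, ht⟩] with s hs
          apply hYout s (Ioo_subset_Icc_self hs.2)
          by_contra hlt
          apply hs.1
          have : |s - τ| < ε / a := by
            rw [lt_div_iff₀ ha]
            linarith
          rw [abs_lt] at this
          exact ⟨by linarith [this.1], by linarith [this.2]⟩
        rw [hev.deriv_eq, h1]
        simp
    have hint : Integrable (S.indicator (fun _ => 2 * a)) volume := by
      rw [integrable_indicator_iff measurableSet_Icc]
      exact integrableOn_const (by simp)
    calc (∫ t in t0..T, |(-(a * v t)) - (-(a * ub t))|)
        = ∫ t in Ioo t0 T, |(-(a * v t)) - (-(a * ub t))| := by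
          rw [intervalIntegral.integral_of_le htT.le, integral_Ioc_eq_integral_Ioo]
      _ ≤ ∫ t in Ioo t0 T, S.indicator (fun _ => 2 * a) t := by
          apply integral_mono_of_nonneg
          · exact Filter.Eventually.of_forall fun t => abs_nonneg _
          · exact hint.integrableOn
          · exact (ae_restrict_iff' measurableSet_Ioo).mpr hbd
      _ ≤ ∫ t, S.indicator (fun _ => 2 * a) t := by
          apply setIntegral_le_integral hint
          exact Filter.Eventually.of_forall fun t => indicator_nonneg (fun _ _ => by positivity) t
      _ = 4 * ε := by
          rw [integral_indicator measurableSet_Icc, setIntegral_const, measureReal_def,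
            Real.volume_Icc, ENNReal.toReal_ofReal (by linarith), smul_eq_mul]
          field_simp
          ring
      _ ≤ δ := by linarith
  have hle := hopt Y v hfeas hdist
  have hcx : FP3Cost lam t0 T xb ub =
      ∫ t in t0..T, -(Real.exp (-(lam * t)) * (X t + -(deriv X t / a))) := by
    apply intervalIntegral.integral_congr_ae
    filter_upwards [hXd] with t h1 ht
    rw [uIoc_of_le htT.le] at ht
    have htI := Ioc_subset_Icc_self ht
    have h3 : g t = -(a * ub t) := indicator_of_mem htI _
    rw [h1, h3, hXx t htI]
    field_simp
    try ring
  have hlt : ∫ t in t0..T, Real.exp (-(lam * t)) * X t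
      < ∫ t in t0..T, Real.exp (-(lam * t)) * Y t := by
    have hEc : Continuous (fun t : ℝ => Real.exp (-(lam * t))) := by fun_prop
    apply intervalIntegral.integral_lt_integral_of_continuousOn_of_le_of_exists_lt htT
      (hEc.mul hXlip.continuous).continuousOn (hEc.mul hYlip.continuous).continuousOn
    · intro t _
      exact mul_le_mul_of_nonneg_left (le_max_left _ _) (Real.exp_pos _).le
    · refine ⟨τ, hτI, mul_lt_mul_of_pos_left ?_ (Real.exp_pos _)⟩
      apply lt_max_of_lt_right
      rw [hXx τ hτI, hxτ]
      simp [hφ, hε]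
  rw [hcx, fp3_cost_formula a lam t0 T ha _ X hXlip] at hle
  have hcy := fp3_cost_formula a lam t0 T ha _ Y hYlip
  unfold FP3Cost at hle
  rw [hcy, hYt0, hYT] at hle
  have hc : 0 < 1 - lam / a := by
    rw [sub_pos, div_lt_one ha]
    exact hal
  have := mul_lt_mul_of_pos_left hlt hc
  linarith
end
end
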